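/- Let N ≥ 2 be an integer, let t₁, ..., t_N be pairwise distinct complex numbers, and let λ₁, ..., λ_N ∈ ℂ. The twisted Garnier hamiltonians G_i := ∑_{j≠i} [ (y_i − y_j)² p_i p_j − 2(λ_i p_j − λ_j p_i)(y_i − y_j) − 2λ_iλ_j ] / (t_j − t_i), regarded as elements of the polynomial ring ℂ[y₁,...,y_N, p₁,...,p_N], pairwise Poisson-commute: {G_i, G_j} = 0 for all i, j ∈ {1,...,N}. -/

import Mathlib

open MvPolynomial

/-- Variables of the polynomial ring ℂ[y₁,...,y_N,p₁,...,p_N]: `Sum.inl k` is `y_k`,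
`Sum.inr k` is `p_k`. -/
abbrev GarnierRing (N : ℕ) := MvPolynomial (Fin N ⊕ Fin N) ℂ

/-- The Poisson bracket {F,G} = ∑_k (∂F/∂p_k · ∂G/∂y_k − ∂F/∂y_k · ∂G/∂p_k). -/
noncomputable def poissonBracket {N : ℕ} (F G : GarnierRing N) : GarnierRing N :=
  ∑ k : Fin N,
    (pderiv (Sum.inr k) F * pderiv (Sum.inl k) G -
      pderiv (Sum.inl k) F * pderiv (Sum.inr k) G)

/-- The twisted Garnier hamiltonian
G_i = ∑_{j≠i} [ (y_i − y_j)² p_i p_j − 2(λ_i p_j − λ_j p_i)(y_i − y_j) − 2λ_iλ_j ] / (t_j − t_i). -/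
noncomputable def twistedGarnierHam {N : ℕ} (t lam : Fin N → ℂ) (i : Fin N) : GarnierRing N :=
  ∑ j ∈ Finset.univ.erase i,
    C ((t j - t i)⁻¹) *
      ((X (Sum.inl i) - X (Sum.inl j)) ^ 2 * (X (Sum.inr i) * X (Sum.inr j))
        - 2 * (C (lam i) * X (Sum.inr j) - C (lam j) * X (Sum.inr i)) *
            (X (Sum.inl i) - X (Sum.inl j))
        - 2 * C (lam i * lam j))

section Bracket

variable {N : ℕ}

theorem poissonBracket_swap (F G : GarnierRing N) :
    poissonBracket F G = -poissonBracket G F := by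
  simp only [poissonBracket, ← Finset.sum_neg_distrib]
  exact Finset.sum_congr rfl fun k _ => by ring

theorem poissonBracket_self (F : GarnierRing N) : poissonBracket F F = 0 :=
  Finset.sum_eq_zero fun k _ => by ring

theorem poissonBracket_add_right (F G H : GarnierRing N) :
    poissonBracket F (G + H) = poissonBracket F G + poissonBracket F H := by
  simp only [poissonBracket, ← Finset.sum_add_distrib, map_add]
  exact Finset.sum_congr rfl fun k _ => by ring

theorem poissonBracket_mul_right (F G H : GarnierRing N) :
    poissonBracket F (G * H) = G * poissonBracket F H + H * poissonBracket F G := by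
  simp only [poissonBracket, Finset.mul_sum, ← Finset.sum_add_distrib, Derivation.leibniz,
    smul_eq_mul]
  exact Finset.sum_congr rfl fun k _ => by ring

theorem poissonBracket_C_right (F : GarnierRing N) (c : ℂ) : poissonBracket F (C c) = 0 := by
  simp [poissonBracket]

/-- The hamiltonian vector field of `F`, as a derivation of the polynomial ring. -/
noncomputable def hamiltonianDerivation (F : GarnierRing N) :
    Derivation ℂ (GarnierRing N) (GarnierRing N) :=
  Derivation.mk'
    { toFun := poissonBracket F
      map_add' := poissonBracket_add_right F
      map_smul' := fun c G => by
        simp [smul_eq_C_mul, poissonBracket_mul_right, poissonBracket_C_right] }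
    (fun G H => by simp [poissonBracket_mul_right])

theorem hamiltonianDerivation_apply (F G : GarnierRing N) :
    hamiltonianDerivation F G = poissonBracket F G := rfl

theorem hamiltonianDerivation_swap (F G : GarnierRing N) :
    hamiltonianDerivation F G = -hamiltonianDerivation G F :=
  poissonBracket_swap F G

theorem hamiltonianDerivation_y_y (a b : Fin N) :
    hamiltonianDerivation (X (Sum.inl a)) (X (Sum.inl b)) = 0 := by
  simp [hamiltonianDerivation_apply, poissonBracket, pderiv_X]

theorem hamiltonianDerivation_p_p (a b : Fin N) :
    hamiltonianDerivation (X (Sum.inr a)) (X (Sum.inr b)) = 0 := by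
  simp [hamiltonianDerivation_apply, poissonBracket, pderiv_X]

theorem hamiltonianDerivation_p_y (a b : Fin N) :
    hamiltonianDerivation (X (Sum.inr a)) (X (Sum.inl b)) = if a = b then 1 else 0 := by
  simp [hamiltonianDerivation_apply, poissonBracket, pderiv_X, Pi.single_apply, eq_comm]

theorem hamiltonianDerivation_y_p (a b : Fin N) :
    hamiltonianDerivation (X (Sum.inl a)) (X (Sum.inr b)) = -if a = b then 1 else 0 := by
  rw [hamiltonianDerivation_swap, hamiltonianDerivation_p_y]
  simp [eq_comm]

/-- The two-site interaction term of the twisted Garnier hamiltonians. -/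
noncomputable def garnierInteraction (lam : Fin N → ℂ) (i j : Fin N) : GarnierRing N :=
  (X (Sum.inl i) - X (Sum.inl j)) ^ 2 * (X (Sum.inr i) * X (Sum.inr j))
    - 2 * (C (lam i) * X (Sum.inr j) - C (lam j) * X (Sum.inr i)) *
        (X (Sum.inl i) - X (Sum.inl j))
    - 2 * C (lam i * lam j)

theorem garnierInteraction_comm (lam : Fin N → ℂ) (i j : Fin N) :
    garnierInteraction lam i j = garnierInteraction lam j i := by
  simp only [garnierInteraction, C_mul]
  ring

theorem hamiltonianDerivation_interaction (F : GarnierRing N) (lam : Fin N → ℂ) (i j : Fin N) :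
    hamiltonianDerivation F (garnierInteraction lam i j) =
      2 * (X (Sum.inl i) - X (Sum.inl j)) * (X (Sum.inr i) * X (Sum.inr j)) *
          (hamiltonianDerivation F (X (Sum.inl i)) - hamiltonianDerivation F (X (Sum.inl j)))
        + (X (Sum.inl i) - X (Sum.inl j)) ^ 2 *
          (X (Sum.inr i) * hamiltonianDerivation F (X (Sum.inr j))
            + X (Sum.inr j) * hamiltonianDerivation F (X (Sum.inr i)))
        - 2 * (C (lam i) * X (Sum.inr j) - C (lam j) * X (Sum.inr i)) *
          (hamiltonianDerivation F (X (Sum.inl i)) - hamiltonianDerivation F (X (Sum.inl j)))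
        - 2 * (C (lam i) * hamiltonianDerivation F (X (Sum.inr j))
            - C (lam j) * hamiltonianDerivation F (X (Sum.inr i))) *
          (X (Sum.inl i) - X (Sum.inl j)) := by
  have h_two : hamiltonianDerivation F 2 = 0 := by
    simpa using (hamiltonianDerivation F).map_natCast 2
  have h_C (c : ℂ) : hamiltonianDerivation F (C c) = 0 := poissonBracket_C_right F c
  simp only [garnierInteraction, map_sub, Derivation.leibniz, pow_two, smul_eq_mul, h_two, h_C]
  ring

theorem poissonBracket_interaction_of_disjoint (lam : Fin N → ℂ) {i j k l : Fin N}
    (hik : i ≠ k) (hil : i ≠ l) (hjk : j ≠ k) (hjl : j ≠ l) :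
    poissonBracket (garnierInteraction lam i j) (garnierInteraction lam k l) = 0 := by
  simp only [← hamiltonianDerivation_apply, hamiltonianDerivation_interaction,
    hamiltonianDerivation_swap (garnierInteraction lam i j) (X _),
    hamiltonianDerivation_y_y, hamiltonianDerivation_p_p, hamiltonianDerivation_p_y,
    hamiltonianDerivation_y_p, hik.symm, hil.symm, hjk.symm, hjl.symm, if_false]
  ring

/-- The classical infinitesimal braid relation satisfied by the interaction terms. -/
theorem poissonBracket_interaction_braid (lam : Fin N → ℂ) {i j k : Fin N}
    (hij : i ≠ j) (hik : i ≠ k) (hjk : j ≠ k) :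
    poissonBracket (garnierInteraction lam i j) (garnierInteraction lam j k) =
      -poissonBracket (garnierInteraction lam i j) (garnierInteraction lam i k) := by
  simp only [← hamiltonianDerivation_apply, hamiltonianDerivation_interaction,
    hamiltonianDerivation_swap (garnierInteraction lam i j) (X _),
    hamiltonianDerivation_y_y, hamiltonianDerivation_p_p, hamiltonianDerivation_p_y,
    hamiltonianDerivation_y_p, hij, hij.symm, hik.symm, hjk.symm, if_false, if_true]
  ring

theorem twistedGarnierHam_eq_sum (t lam : Fin N → ℂ) (i : Fin N) :
    twistedGarnierHam t lam i = ∑ j, (t j - t i)⁻¹ • garnierInteraction lam i j := by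
  simp only [twistedGarnierHam, smul_eq_C_mul]
  exact Finset.sum_erase _ (by simp)

theorem poissonBracket_sum_smul {ι κ : Type*} [Fintype ι] [Fintype κ] (a : ι → ℂ) (b : κ → ℂ)
    (F : ι → GarnierRing N) (G : κ → GarnierRing N) :
    poissonBracket (∑ k, a k • F k) (∑ l, b l • G l) =
      ∑ k, ∑ l, (a k * b l) • poissonBracket (F k) (G l) := by
  simp only [← hamiltonianDerivation_apply, map_sum, Derivation.map_smul]
  rw [Finset.sum_comm]
  refine Finset.sum_congr rfl fun l _ => ?_
  rw [hamiltonianDerivation_swap, map_sum, ← Finset.sum_neg_distrib, Finset.smul_sum]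
  refine Finset.sum_congr rfl fun k _ => ?_
  rw [Derivation.map_smul, hamiltonianDerivation_swap (G l), smul_neg, smul_neg, smul_neg,
    neg_neg, smul_smul, mul_comm]

end Bracket

theorem sum_sum_eq_sum_of_support {ι M : Type*} [Fintype ι] [DecidableEq ι] [AddCommMonoid M]
    {i j : ι} (f : ι → ι → M) (hi : ∀ l, f i l = 0) (hj : ∀ k, f k j = 0) (hji : f j i = 0)
    (hf : ∀ k l, k ≠ l → k ≠ j → l ≠ i → f k l = 0) :
    ∑ k, ∑ l, f k l = ∑ k, (f k k + f j k + f k i) := by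
  have h (k l : ι) : f k l =
      (if k = l then f k k else 0) + (if k = j then f j l else 0)
        + (if l = i then f k i else 0) := by
    rcases eq_or_ne k j with rfl | hkj
    · rcases eq_or_ne l i with rfl | hli
      · simp [hji, hj]
      · simp [hli, hj]
    · rcases eq_or_ne l i with rfl | hli
      · simp +contextual [hkj, hi]
      · rcases eq_or_ne k l with rfl | hkl
        · simp [hkj, hli]
        · simp [hkj, hli, hkl, hf]
  rw [Finset.sum_congr rfl fun k _ => Finset.sum_congr rfl fun l _ => h k l]
  simp only [Finset.sum_add_distrib]
  rw [Finset.sum_comm (f := fun k l => if k = j then f j l else 0)]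
  simp

theorem twisted_garnier_poisson_commute (N : ℕ) (hN : 2 ≤ N) (t : Fin N → ℂ)
    (ht : Function.Injective t) (lam : Fin N → ℂ) (i j : Fin N) :
    poissonBracket (twistedGarnierHam t lam i) (twistedGarnierHam t lam j) = 0 := by
  rcases eq_or_ne i j with rfl | hij
  · exact poissonBracket_self _
  have hsub {a b : Fin N} (hab : a ≠ b) : t a - t b ≠ 0 := sub_ne_zero.mpr (ht.ne hab)
  rw [twistedGarnierHam_eq_sum, twistedGarnierHam_eq_sum, poissonBracket_sum_smul,
    sum_sum_eq_sum_of_support (i := i) (j := j)]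
  · refine Finset.sum_eq_zero fun k _ => ?_
    rcases eq_or_ne k i with rfl | hki
    · simp [garnierInteraction_comm lam j k, poissonBracket_self]
    rcases eq_or_ne k j with rfl | hkj
    · simp [garnierInteraction_comm lam k i, poissonBracket_self]
    have h₁ := poissonBracket_interaction_braid lam hki.symm hij hkj
    have h₂ := poissonBracket_interaction_braid lam hij hki.symm hkj.symm
    rw [garnierInteraction_comm lam k j] at h₁
    rw [poissonBracket_swap (garnierInteraction lam i j) (garnierInteraction lam i k),
      neg_neg] at h₂
    rw [garnierInteraction_comm lam j i, h₂, h₁, smul_neg, ← neg_smul, ← add_smul, ← add_smul]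
    have h_coeff : -((t k - t i)⁻¹ * (t k - t j)⁻¹) + (t j - t i)⁻¹ * (t k - t j)⁻¹
        + (t k - t i)⁻¹ * (t i - t j)⁻¹ = 0 := by
      rw [← neg_sub (t j) (t i)]
      field_simp [hsub hki, hsub hkj, hsub hij.symm]
      ring
    rw [h_coeff, zero_smul]
  · simp
  · simp
  · simp [garnierInteraction_comm lam j i, poissonBracket_self]
  · intro k l hkl hkj hli
    rcases eq_or_ne k i with rfl | hki
    · simp
    rcases eq_or_ne l j with rfl | hlj
    · simp
    rw [poissonBracket_interaction_of_disjoint lam hij hli.symm hkj hkl, smul_zero]
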